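/- Suppose (x₀, x₁) ≠ (0, 0). Then lim_{n→∞} (SS(n))^{1/n} = 1 + √5, where SS(n) is the n-th row sum of squares; equivalently, the second raw moment SS(n)/2ⁿ of x_{n+1} grows with n-th root tending to (1 + √5)/2. -/

import Mathlib

open Filter

/-- The random Fibonacci sequence determined by initial values `x0, x1` and the
sign sequence `ε : Fin n → Bool` (`true` ↦ `+1`, `false` ↦ `-1`):
`x 0 = x0`, `x 1 = x1`, `x (k+2) = (±1) * x (k+1) + x k` where the sign is `ε k`. -/
noncomputable def randFib (x0 x1 : ℝ) {n : ℕ} (ε : Fin n → Bool) : ℕ → ℝ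
  | 0 => x0
  | 1 => x1
  | k + 2 =>
      (if h : k < n then (if ε ⟨k, h⟩ then (1 : ℝ) else -1) else 1) *
        randFib x0 x1 ε (k + 1) + randFib x0 x1 ε k

/-- `rowSumSq x0 x1 n` is the sum of the squares of the `n`-th row of the tree
of all `2^n` random Fibonacci sequences with initial values `x0, x1`. -/
noncomputable def rowSumSq (x0 x1 : ℝ) (n : ℕ) : ℝ :=
  ∑ ε : Fin n → Bool, (randFib x0 x1 ε (n + 1)) ^ 2

theorem randFib_cons (x0 x1 : ℝ) {n : ℕ} (b : Bool) (ε : Fin n → Bool) (k : ℕ) :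
    randFib x0 x1 (Fin.cons b ε : Fin (n + 1) → Bool) (k + 1) =
      randFib x1 ((if b then (1 : ℝ) else -1) * x1 + x0) ε k := by
  induction k using Nat.twoStepInduction with
  | zero => simp [randFib]
  | one => simp [randFib]
  | more k ih₁ ih₂ =>
    rw [randFib.eq_3 x0 x1 _ (k + 1), ih₁, ih₂, randFib.eq_3]
    congr 2
    by_cases h : k < n
    · have h₁ : k + 1 < n + 1 := by omega
      rw [dif_pos h, dif_pos h₁]
      exact congrArg (fun c : Bool => if c then (1 : ℝ) else -1)
        (Fin.cons_succ (α := fun _ => Bool) b ε ⟨k, h⟩)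
    · have h₁ : ¬ k + 1 < n + 1 := by omega
      rw [dif_neg h, dif_neg h₁]

theorem rowSumSq_zero (x0 x1 : ℝ) : rowSumSq x0 x1 0 = x1 ^ 2 := by
  simp [rowSumSq, randFib]

theorem rowSumSq_succ (x0 x1 : ℝ) (n : ℕ) :
    rowSumSq x0 x1 (n + 1) = rowSumSq x1 (x1 + x0) n + rowSumSq x1 (-x1 + x0) n := by
  unfold rowSumSq
  rw [← (Fin.consEquiv fun _ : Fin (n + 1) => Bool).sum_comp, Fintype.sum_prod_type]
  simp [Fin.consEquiv, randFib_cons]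

theorem rowSumSq_le (x0 x1 : ℝ) (n : ℕ) :
    rowSumSq x0 x1 n ≤ ((1 + √5) * x1 ^ 2 + 2 * x0 ^ 2) * (1 + √5) ^ n := by
  have h5 : √5 ^ 2 = 5 := Real.sq_sqrt (by norm_num)
  induction n generalizing x0 x1 with
  | zero =>
    rw [rowSumSq_zero]
    nlinarith [mul_nonneg (Real.sqrt_nonneg 5) (sq_nonneg x1), sq_nonneg x0]
  | succ n ih =>
    rw [rowSumSq_succ]
    refine (add_le_add (ih _ _) (ih _ _)).trans_eq ?_
    linear_combination (-(1 + √5) ^ n * x1 ^ 2) * h5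

theorem le_rowSumSq_succ (x0 x1 : ℝ) (n : ℕ) :
    ((1 + √5) * x1 ^ 2 + 2 * x0 ^ 2) / 2 * (1 + √5) ^ n ≤ rowSumSq x0 x1 (n + 1) := by
  have h5 : √5 ^ 2 = 5 := Real.sq_sqrt (by norm_num)
  induction n generalizing x0 x1 with
  | zero =>
    have h3 : √5 ≤ 3 := by rw [Real.sqrt_le_left (by norm_num)]; norm_num
    rw [rowSumSq_succ, rowSumSq_zero, rowSumSq_zero]
    nlinarith [mul_nonneg (sub_nonneg.2 h3) (sq_nonneg x1), sq_nonneg x0]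
  | succ n ih =>
    rw [rowSumSq_succ]
    refine Eq.trans_le ?_ (add_le_add (ih _ _) (ih _ _))
    linear_combination ((1 + √5) ^ n * x1 ^ 2 / 2) * h5

theorem tendsto_mul_pow_rpow_inv {c r : ℝ} (hc : 0 < c) (hr : 0 ≤ r) :
    Tendsto (fun n : ℕ => (c * r ^ n) ^ ((n : ℝ)⁻¹)) atTop (nhds r) := by
  have h : Tendsto (fun n : ℕ => c ^ ((n : ℝ)⁻¹) * r) atTop (nhds (c ^ (0 : ℝ) * r)) :=
    ((Real.continuousAt_const_rpow hc.ne').tendsto.comp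
      (tendsto_inv_atTop_nhds_zero_nat (𝕜 := ℝ))).mul_const r
  rw [Real.rpow_zero, one_mul] at h
  refine h.congr' ?_
  filter_upwards [eventually_ne_atTop 0] with n hn
  rw [Real.mul_rpow hc.le (pow_nonneg hr n), Real.pow_rpow_inv_natCast hr hn]

theorem rowSumSq_root_tendsto (x0 x1 : ℝ) (hx : (x0, x1) ≠ (0, 0)) :
    Tendsto (fun n : ℕ => rowSumSq x0 x1 n ^ ((n : ℝ)⁻¹)) atTop
      (nhds (1 + Real.sqrt 5)) := by
  have hr : 0 < 1 + √5 := by positivity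
  have hQ : 0 < (1 + √5) * x1 ^ 2 + 2 * x0 ^ 2 := by
    by_cases h : x0 = 0
    · have h1 : x1 ≠ 0 := fun h1 => hx (by rw [h, h1])
      positivity
    · positivity
  refine tendsto_of_tendsto_of_tendsto_of_le_of_le'
    (tendsto_mul_pow_rpow_inv (div_pos (half_pos hQ) hr) hr.le)
    (tendsto_mul_pow_rpow_inv hQ hr.le) ?_ ?_
  · filter_upwards [eventually_ne_atTop 0] with n hn
    obtain ⟨m, rfl⟩ := Nat.exists_eq_succ_of_ne_zero hn
    refine Real.rpow_le_rpow (by positivity) ?_ (by positivity)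
    refine Eq.trans_le ?_ (le_rowSumSq_succ x0 x1 m)
    rw [Nat.succ_eq_add_one, pow_succ]
    field_simp
    ring
  · exact Eventually.of_forall fun n => Real.rpow_le_rpow
      (Finset.sum_nonneg fun _ _ => sq_nonneg _) (rowSumSq_le x0 x1 n) (by positivity)
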